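/- For every finite vertex set K ⊆ V, the hinge measure h_K(x,y) := e_K(x) · P_x[λ_K < ∞ and X_{λ_K} = y] is symmetric: h_K(x,y) = h_K(y,x) for all x, y ∈ V; explicitly, a_x · P_x[τ_K^+=∞] · P_x[λ_K < ∞, X_{λ_K}=y] = a_y · P_y[τ_K^+=∞] · P_y[λ_K < ∞, X_{λ_K}=x] for all x, y ∈ K. -/

import Mathlib

open MeasureTheory Filter

section Setup

variable {V : Type*} [MeasurableSpace V]

/-- Total weight at a vertex: `a_x = Σ_{z∼x} a_{x,z}`. -/
noncomputable def aTot (G : SimpleGraph V) [G.LocallyFinite] (a : V → V → ℝ) (x : V) : ℝ :=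
  ∑ z ∈ G.neighborFinset x, a x z

open Classical in
/-- Transition probabilities of the weighted random walk:
`p(x,y) = a_{x,y}/a_x` for edges and `0` otherwise. -/
noncomputable def step (G : SimpleGraph V) [G.LocallyFinite] (a : V → V → ℝ) (x y : V) : ℝ :=
  if G.Adj x y then a x y / aTot G a x else 0

/-- The event `{τ_K^+ = ∞}`: the walk never returns to `K` at a time `n ≥ 1`. -/
def noReturn (K : Set V) : Set (ℕ → V) := {w | ∀ n ≥ 1, w n ∉ K}

/-- The event `{τ_K < ∞}`: the walk hits `K`. -/
def hits (K : Set V) : Set (ℕ → V) := {w | ∃ n, w n ∈ K}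

/-- The event `{τ_K < ∞ and X_{τ_K} = y}`: the walk hits `K`, entering it at `y`. -/
def hitsAt (K : Set V) (y : V) : Set (ℕ → V) :=
  {w | (∃ n, w n ∈ K) ∧ w (sInf {n | w n ∈ K}) = y}

/-- The event `{λ_K < ∞ and X_{λ_K} = y}`: the walk visits `K`, finitely often,
and its last visit to `K` is at `y`. -/
def lastVisitAt (K : Set V) (y : V) : Set (ℕ → V) :=
  {w | (∃ n, w n ∈ K) ∧ {n | w n ∈ K}.Finite ∧ w (sSup {n | w n ∈ K}) = y}

open Classical in
/-- The equilibrium measure of a finite vertex set `K`: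
`e_K(x) = a_x · P_x[τ_K^+ = ∞]` for `x ∈ K`, and `0` otherwise. -/
noncomputable def equil (G : SimpleGraph V) [G.LocallyFinite] (a : V → V → ℝ)
    (P : V → Measure (ℕ → V)) (K : Finset V) (x : V) : ℝ :=
  if x ∈ K then aTot G a x * ((P x) (noReturn (K : Set V))).toReal else 0

/-- The capacity of a finite vertex set `K`: `cap(K) = Σ_{x∈K} e_K(x)`. -/
noncomputable def capa (G : SimpleGraph V) [G.LocallyFinite] (a : V → V → ℝ)
    (P : V → Measure (ℕ → V)) (K : Finset V) : ℝ :=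
  ∑ x ∈ K, equil G a P K x

/-- The harmonic measure of a nonempty finite vertex set `K`: `harm_K = e_K / cap(K)`. -/
noncomputable def harm (G : SimpleGraph V) [G.LocallyFinite] (a : V → V → ℝ)
    (P : V → Measure (ℕ → V)) (K : Finset V) (x : V) : ℝ :=
  equil G a P K x / capa G a P K

end Setup

section MarkovChain

open scoped ENNReal

variable {V : Type*}

/-- The cylinder of paths that agree with `c` up to time `n`. -/
def pathCylinder (n : ℕ) (c : ℕ → V) : Set (ℕ → V) := {w | ∀ i ≤ n, w i = c i}

theorem measurableSet_pathCylinder [MeasurableSpace V] [DiscreteMeasurableSpace V] (n : ℕ)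
    (c : ℕ → V) : MeasurableSet (pathCylinder n c) := by
  have : pathCylinder n c = ⋂ i, ⋂ (_ : i ≤ n), (fun w : ℕ → V => w i) ⁻¹' {c i} := by
    ext w; simp [pathCylinder]
  rw [this]
  exact .iInter fun i => .iInter fun _ => measurable_pi_apply i (.of_discrete)

theorem isPiSystem_pathCylinder :
    IsPiSystem {A : Set (ℕ → V) | ∃ n c, A = pathCylinder n c} := by
  rintro _ ⟨n, c, rfl⟩ _ ⟨m, d, rfl⟩ ⟨u, hu, hu'⟩
  refine ⟨max n m, u, ?_⟩
  ext w
  simp only [pathCylinder, Set.mem_inter_iff, Set.mem_ofPred_eq] at *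
  constructor
  · rintro ⟨h, h'⟩ i hi
    rcases le_max_iff.1 hi with hi | hi
    · rw [h i hi, hu i hi]
    · rw [h' i hi, hu' i hi]
  · intro h
    exact ⟨fun i hi => by rw [h i (hi.trans (le_max_left _ _)), hu i hi],
      fun i hi => by rw [h i (hi.trans (le_max_right _ _)), hu' i hi]⟩

theorem generateFrom_pathCylinder [Countable V] [MeasurableSpace V] [DiscreteMeasurableSpace V] :
    (MeasurableSpace.pi : MeasurableSpace (ℕ → V)) =
      MeasurableSpace.generateFrom {A : Set (ℕ → V) | ∃ n c, A = pathCylinder n c} := by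
  apply le_antisymm
  · refine iSup_le fun i => ?_
    rintro _ ⟨s, -, rfl⟩
    have : (fun w : ℕ → V => w i) ⁻¹' s =
        ⋃ (g : Fin (i + 1) → V) (_ : g (Fin.last i) ∈ s),
          pathCylinder i (fun j => g (Fin.ofNat (i + 1) j)) := by
      ext w
      simp only [Set.mem_preimage, Set.mem_iUnion, pathCylinder, Set.mem_ofPred_eq, exists_prop]
      constructor
      · intro h
        refine ⟨fun j => w j, by simpa using h, fun j hj => ?_⟩
        simp [Fin.ofNat, Nat.mod_eq_of_lt (Nat.lt_succ_of_le hj)]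
      · rintro ⟨g, hg, h⟩
        rw [h i le_rfl]
        convert hg
        simp [Fin.ofNat, Fin.last]
    rw [this]
    exact .iUnion fun g => .iUnion fun _ => MeasurableSpace.measurableSet_generateFrom ⟨_, _, rfl⟩
  · refine MeasurableSpace.generateFrom_le ?_
    rintro _ ⟨n, c, rfl⟩
    exact measurableSet_pathCylinder n c

/-- The time shift on path space. -/
def pathShift (n : ℕ) (w : ℕ → V) : ℕ → V := fun i => w (i + n)

theorem mem_pathShift_preimage_noReturn {K : Set V} {n : ℕ} {w : ℕ → V} :
    w ∈ pathShift n ⁻¹' noReturn K ↔ ∀ m > n, w m ∉ K := by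
  change (∀ i ≥ 1, w (i + n) ∉ K) ↔ _
  constructor
  · intro h m hm
    simpa [Nat.sub_add_cancel hm.le] using h (m - n) (by omega)
  · exact fun h i hi => h _ (by omega)

theorem lastVisitAt_eq_iUnion {K : Set V} {y : V} (hy : y ∈ K) :
    lastVisitAt K y = ⋃ n, ({w | w n = y} ∩ pathShift n ⁻¹' noReturn K) := by
  ext w
  simp only [Set.mem_iUnion, Set.mem_inter_iff, mem_pathShift_preimage_noReturn,
    Set.mem_ofPred_eq]
  constructor
  · rintro ⟨-, hfin, h⟩
    exact ⟨_, h, fun m hm hmK => hm.not_ge (le_csSup hfin.bddAbove hmK)⟩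
  · rintro ⟨n, hn, h⟩
    have hle : ∀ m ∈ {n | w n ∈ K}, m ≤ n := fun m hm => not_lt.1 fun hlt => h m hlt hm
    have hmem : n ∈ {n | w n ∈ K} := by simpa [hn] using hy
    have hsup : sSup {n | w n ∈ K} = n := IsGreatest.csSup_eq ⟨hmem, hle⟩
    exact ⟨⟨n, hmem⟩, (Set.finite_Iic n).subset hle, by rw [hsup, hn]⟩

theorem lastVisitAt_eq_empty {K : Set V} {y : V} (hy : y ∉ K) : lastVisitAt K y = ∅ := by
  ext w
  simp only [Set.mem_empty_iff_false, iff_false]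
  rintro ⟨hne, hfin, h⟩
  have : sSup {n | w n ∈ K} ∈ {n | w n ∈ K} := Nat.sSup_mem hne hfin.bddAbove
  exact hy (h ▸ this)

theorem measurable_pathShift [MeasurableSpace V] (n : ℕ) :
    Measurable (pathShift n : (ℕ → V) → ℕ → V) :=
  measurable_pi_lambda _ fun i => measurable_pi_apply (i + n)

theorem measurableSet_eval_eq [MeasurableSpace V] [DiscreteMeasurableSpace V] (n : ℕ) (y : V) :
    MeasurableSet {w : ℕ → V | w n = y} :=
  (measurable_pi_apply n : Measurable fun w : ℕ → V => w n) (.of_discrete (s := {y}))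

/-- A set of paths is decomposed according to the position of the path at time `n`. -/
theorem measure_eq_tsum_eval [Countable V] [MeasurableSpace V] [DiscreteMeasurableSpace V]
    (μ : Measure (ℕ → V)) (n : ℕ) {B : Set (ℕ → V)}
    (hB : MeasurableSet B) : μ B = ∑' z, μ ({w | w n = z} ∩ B) := by
  rw [← measure_iUnion]
  · congr 1
    ext w
    simp
  · intro z z' h
    refine Set.disjoint_left.2 ?_
    rintro w ⟨h1, -⟩ ⟨h2, -⟩
    exact h (h1.symm.trans h2)
  · exact fun z => (measurableSet_eval_eq n z).inter hB

variable [MeasurableSpace V] {P : V → Measure (ℕ → V)} {p : V → V → ℝ≥0∞}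

open Classical in
/-- The laws `P x` are those of the Markov chain with transition probabilities `p`. -/
def IsMarkovFamily (P : V → Measure (ℕ → V)) (p : V → V → ℝ≥0∞) : Prop :=
  ∀ (x : V) (n : ℕ) (c : ℕ → V), P x (pathCylinder n c) =
    (if c 0 = x then 1 else 0) * ∏ i ∈ Finset.range n, p (c i) (c (i + 1))

namespace IsMarkovFamily

theorem measure_start (hP : IsMarkovFamily P p) (x : V) : P x {w | w 0 = x} = 1 := by
  have := hP x 0 (fun _ => x)
  simpa [pathCylinder] using this

variable [DiscreteMeasurableSpace V] [∀ x, IsProbabilityMeasure (P x)]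

theorem ae_start (hP : IsMarkovFamily P p) (x : V) : ∀ᵐ w ∂P x, w 0 = x :=
  (mem_ae_iff_prob_eq_one (measurableSet_eval_eq 0 x)).2 (hP.measure_start x)

theorem measure_eval_one_inter (hP : IsMarkovFamily P p) (x y : V) (n : ℕ) (c : ℕ → V) :
    P x ({w | w 1 = y} ∩ pathShift 1 ⁻¹' pathCylinder n c) = p x y * P y (pathCylinder n c) := by
  classical
  by_cases hc : c 0 = y
  · have h1 : P x ({w | w 1 = y} ∩ pathShift 1 ⁻¹' pathCylinder n c) =
        P x (pathCylinder (n + 1) (fun i => if i = 0 then x else c (i - 1))) := by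
      refine measure_congr ?_
      filter_upwards [hP.ae_start x] with w hw
      apply propext
      change (w 1 = y ∧ ∀ i ≤ n, w (i + 1) = c i) ↔
        ∀ i ≤ n + 1, w i = if i = 0 then x else c (i - 1)
      constructor
      · rintro ⟨-, h⟩ i hi
        cases i with
        | zero => simpa using hw
        | succ i => simpa using h i (by omega)
      · intro h
        have h' : ∀ i ≤ n, w (i + 1) = c i := fun i hi => by simpa using h (i + 1) (by omega)
        exact ⟨by rw [← hc]; exact h' 0 (Nat.zero_le _), h'⟩
    rw [h1, hP, hP, Finset.prod_range_succ']
    simp [hc, mul_comm]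
  · rw [hP, if_neg hc, zero_mul, mul_zero]
    convert measure_empty (μ := P x)
    ext w
    simp only [Set.mem_inter_iff, Set.mem_ofPred_eq, Set.mem_preimage, Set.mem_empty_iff_false,
      iff_false, not_and]
    intro h h'
    exact hc ((h' 0 (Nat.zero_le _)).symm.trans h)

theorem measure_eval_one (hP : IsMarkovFamily P p) (x y : V) : P x {w | w 1 = y} = p x y := by
  have h := hP.measure_eval_one_inter x y 0 (fun _ => y)
  have h0 : pathCylinder 0 (fun _ => y) = {w : ℕ → V | w 0 = y} := by ext; simp [pathCylinder]
  rw [h0, hP.measure_start, mul_one] at h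
  rw [← h]
  congr 1
  ext w
  simp [pathShift]

theorem map_pathShift_one [Countable V] (hP : IsMarkovFamily P p) (x y : V) :
    ((P x).restrict {w | w 1 = y}).map (pathShift 1) = p x y • P y := by
  refine ext_of_generate_finite _ generateFrom_pathCylinder isPiSystem_pathCylinder ?_ ?_
  · rintro _ ⟨n, c, rfl⟩
    rw [Measure.map_apply (measurable_pathShift 1) (measurableSet_pathCylinder n c),
      Measure.restrict_apply (measurable_pathShift 1 (measurableSet_pathCylinder n c)),
      Set.inter_comm, hP.measure_eval_one_inter]
    rfl
  · rw [Measure.map_apply (measurable_pathShift 1) .univ]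
    simp [hP.measure_eval_one]

/-- First-step decomposition. -/
theorem measure_preimage_pathShift_one [Countable V]
    (hP : IsMarkovFamily P p) (x : V) {A : Set (ℕ → V)}
    (hA : MeasurableSet A) : P x (pathShift 1 ⁻¹' A) = ∑' z, p x z * P z A := by
  rw [measure_eq_tsum_eval (P x) 1 (measurable_pathShift 1 hA)]
  refine tsum_congr fun z => ?_
  have h := congrArg (fun μ => μ A) (hP.map_pathShift_one x z)
  rw [Measure.map_apply (measurable_pathShift 1) hA,
    Measure.restrict_apply (measurable_pathShift 1 hA), Set.inter_comm] at h
  simpa using h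

/-- The Markov property at a deterministic time. -/
theorem measure_eval_inter_preimage_pathShift [Countable V]
    (hP : IsMarkovFamily P p) {A : Set (ℕ → V)}
    (hA : MeasurableSet A) (y : V) (n : ℕ) (x : V) :
    P x ({w | w n = y} ∩ pathShift n ⁻¹' A) = P x {w | w n = y} * P y A := by
  induction n generalizing x with
  | zero =>
    by_cases hxy : x = y
    · subst hxy
      rw [hP.measure_start, one_mul]
      refine measure_congr ?_
      filter_upwards [hP.ae_start x] with w hw
      apply propext
      change (w 0 = x ∧ w ∈ A) ↔ w ∈ A
      simp [hw]
    · have h0 : P x {w | w 0 = y} = 0 := by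
        rw [measure_eq_zero_iff_ae_notMem]
        filter_upwards [hP.ae_start x] with w hw h
        exact hxy (hw.symm.trans h)
      rw [h0, zero_mul]
      exact measure_mono_null Set.inter_subset_left h0
  | succ n ih =>
    have h1 : ({w | w (n + 1) = y} ∩ pathShift (n + 1) ⁻¹' A : Set (ℕ → V)) =
        pathShift 1 ⁻¹' ({w | w n = y} ∩ pathShift n ⁻¹' A) := rfl
    have h2 : ({w | w (n + 1) = y} : Set (ℕ → V)) = pathShift 1 ⁻¹' {w | w n = y} := rfl
    rw [h1, h2, hP.measure_preimage_pathShift_one x (measurableSet_eval_eq n y),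
      hP.measure_preimage_pathShift_one x
        ((measurableSet_eval_eq n y).inter (measurable_pathShift n hA)), ← ENNReal.tsum_mul_right]
    exact tsum_congr fun z => by rw [ih, mul_assoc]

/-- Last-step decomposition of the transition probabilities. -/
theorem measure_eval_succ [Countable V] (hP : IsMarkovFamily P p) (x y : V) (n : ℕ) :
    P x {w | w (n + 1) = y} = ∑' z, P x {w | w n = z} * p z y := by
  rw [measure_eq_tsum_eval (P x) n (measurableSet_eval_eq (n + 1) y)]
  refine tsum_congr fun z => ?_
  rw [← hP.measure_eval_one z y,
    ← hP.measure_eval_inter_preimage_pathShift (measurableSet_eval_eq 1 y) z n x]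
  congr 2
  ext w
  simp [pathShift, add_comm]

/-- Detailed balance is inherited by the transition probabilities of every order. -/
theorem detailed_balance [Countable V] (hP : IsMarkovFamily P p) {m : V → ℝ≥0∞}
    (hm : ∀ x y, m x * p x y = m y * p y x) (n : ℕ) (x y : V) :
    m x * P x {w | w n = y} = m y * P y {w | w n = x} := by
  induction n generalizing x y with
  | zero =>
    by_cases hxy : x = y
    · rw [hxy]
    · have h0 : ∀ u v : V, u ≠ v → P u {w | w 0 = v} = 0 := fun u v huv => by
        rw [measure_eq_zero_iff_ae_notMem]
        filter_upwards [hP.ae_start u] with w hw h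
        exact huv (hw.symm.trans h)
      rw [h0 x y hxy, h0 y x (Ne.symm hxy), mul_zero, mul_zero]
  | succ n ih =>
    have h2 : ({w | w (n + 1) = y} : Set (ℕ → V)) = pathShift 1 ⁻¹' {w | w n = y} := rfl
    rw [hP.measure_eval_succ y x n, h2,
      hP.measure_preimage_pathShift_one x (measurableSet_eval_eq n y), ← ENNReal.tsum_mul_left,
      ← ENNReal.tsum_mul_left]
    refine tsum_congr fun z => ?_
    rw [← mul_assoc, hm, mul_right_comm, ih, mul_assoc]

end IsMarkovFamily

theorem measurableSet_noReturn [DiscreteMeasurableSpace V] (K : Set V) :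
    MeasurableSet (noReturn K) := by
  have : noReturn K = ⋂ n, ⋂ (_ : n ≥ 1), (fun w : ℕ → V => w n) ⁻¹' Kᶜ := by
    ext w; simp [noReturn]
  rw [this]
  exact .iInter fun n => .iInter fun _ => measurable_pi_apply n (.of_discrete)

/-- Last-exit decomposition. -/
theorem IsMarkovFamily.measure_lastVisitAt [Countable V] [DiscreteMeasurableSpace V]
    [∀ x, IsProbabilityMeasure (P x)]
    (hP : IsMarkovFamily P p) {K : Set V} {y : V} (hy : y ∈ K) (x : V) :
    P x (lastVisitAt K y) = (∑' n, P x {w | w n = y}) * P y (noReturn K) := by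
  rw [lastVisitAt_eq_iUnion hy, measure_iUnion, ← ENNReal.tsum_mul_right]
  · exact tsum_congr fun n =>
      hP.measure_eval_inter_preimage_pathShift (measurableSet_noReturn K) y n x
  · have key : ∀ (m n : ℕ) (w : ℕ → V), w n = y → w ∈ pathShift m ⁻¹' noReturn K → n ≤ m :=
      fun m n w hn hm => not_lt.1 fun hlt =>
        mem_pathShift_preimage_noReturn.1 hm n hlt (hn ▸ hy)
    intro m n hmn
    refine Set.disjoint_left.2 ?_
    rintro w ⟨hm, hm'⟩ ⟨hn, hn'⟩
    exact hmn (le_antisymm (key n m w hm hn') (key m n w hn hm'))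
  · exact fun n => (measurableSet_eval_eq n y).inter
      (measurable_pathShift n (measurableSet_noReturn K))

end MarkovChain

theorem aTot_nonneg {V : Type*} {G : SimpleGraph V} [G.LocallyFinite] {a : V → V → ℝ}
    (hpos : ∀ x y, G.Adj x y → 0 < a x y) (x : V) : 0 ≤ aTot G a x :=
  Finset.sum_nonneg fun z hz => (hpos x z (by simpa using hz)).le

theorem aTot_mul_step {V : Type*} {G : SimpleGraph V} [G.LocallyFinite] {a : V → V → ℝ}
    (hpos : ∀ x y, G.Adj x y → 0 < a x y) {x y : V} (hxy : G.Adj x y) :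
    aTot G a x * step G a x y = a x y := by
  have h : 0 < aTot G a x :=
    Finset.sum_pos (fun z hz => hpos x z (by simpa using hz)) ⟨y, by simpa using hxy⟩
  rw [step, if_pos hxy, mul_div_cancel₀ _ h.ne']

theorem step_detailed_balance {V : Type*} {G : SimpleGraph V} [G.LocallyFinite] {a : V → V → ℝ}
    (hsymm : ∀ x y, a x y = a y x) (hpos : ∀ x y, G.Adj x y → 0 < a x y) (x y : V) :
    aTot G a x * step G a x y = aTot G a y * step G a y x := by
  by_cases hxy : G.Adj x y
  · rw [aTot_mul_step hpos hxy, aTot_mul_step hpos hxy.symm, hsymm]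
  · have hyx : ¬ G.Adj y x := fun h => hxy h.symm
    simp [step, hxy, hyx]

open ProbabilityTheory in
open Classical in
/-- The hinge measure `h_K(x,y) = e_K(x) · P_x[λ_K < ∞, X_{λ_K} = y]` of a finite vertex set
`K` is symmetric: `h_K(x,y) = h_K(y,x)` for all `x, y ∈ V`; explicitly,
`a_x·P_x[τ_K^+=∞]·P_x[λ_K < ∞, X_{λ_K}=y] = a_y·P_y[τ_K^+=∞]·P_y[λ_K < ∞, X_{λ_K}=x]`
for `x, y ∈ K`. -/
theorem hinge_measure_symm
    {V : Type*} [Countable V] [MeasurableSpace V] [DiscreteMeasurableSpace V]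
    (G : SimpleGraph V) [G.LocallyFinite] (hconn : G.Connected)
    (a : V → V → ℝ)
    (hsymm : ∀ x y, a x y = a y x)
    (hpos : ∀ x y, G.Adj x y → 0 < a x y)
    (P : V → Measure (ℕ → V)) (hprob : ∀ x, IsProbabilityMeasure (P x))
    (hP : ∀ (x : V) (n : ℕ) (c : ℕ → V),
      P x {w | ∀ i ≤ n, w i = c i} =
        (if c 0 = x then 1 else 0) *
          ∏ i ∈ Finset.range n, ENNReal.ofReal (step G a (c i) (c (i + 1))))
    (htrans : ∀ x y : V, ∀ᵐ w ∂ P x, {n : ℕ | w n = y}.Finite)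
    (K : Finset V) (x y : V) :
    equil G a P K x * ((P x) (lastVisitAt (K : Set V) y)).toReal =
      equil G a P K y * ((P y) (lastVisitAt (K : Set V) x)).toReal := by
  have hM : IsMarkovFamily P (fun x y => ENNReal.ofReal (step G a x y)) := by
    intro x n c
    rw [pathCylinder, hP x n c]
  by_cases hx : x ∈ K <;> by_cases hy : y ∈ K
  · have hbal := hM.detailed_balance (m := fun x => ENNReal.ofReal (aTot G a x)) fun u v => by
      rw [← ENNReal.ofReal_mul (aTot_nonneg hpos u), ← ENNReal.ofReal_mul (aTot_nonneg hpos v),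
        step_detailed_balance hsymm hpos]
    have hgreen : ENNReal.ofReal (aTot G a x) * ∑' n, P x {w | w n = y} =
        ENNReal.ofReal (aTot G a y) * ∑' n, P y {w | w n = x} := by
      rw [← ENNReal.tsum_mul_left, ← ENNReal.tsum_mul_left]
      exact tsum_congr fun n => hbal n x y
    have hreal := congrArg ENNReal.toReal hgreen
    rw [ENNReal.toReal_mul, ENNReal.toReal_mul, ENNReal.toReal_ofReal (aTot_nonneg hpos x),
      ENNReal.toReal_ofReal (aTot_nonneg hpos y)] at hreal
    rw [equil, equil, if_pos hx, if_pos hy,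
      hM.measure_lastVisitAt (Finset.mem_coe.2 hy), hM.measure_lastVisitAt (Finset.mem_coe.2 hx),
      ENNReal.toReal_mul, ENNReal.toReal_mul]
    linear_combination
      (P x (noReturn (K : Set V))).toReal * (P y (noReturn (K : Set V))).toReal * hreal
  · rw [lastVisitAt_eq_empty (by simpa using hy)]
    simp [equil, hy]
  · rw [lastVisitAt_eq_empty (y := x) (by simpa using hx)]
    simp [equil, hx]
  · simp [equil, hx, hy]
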